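/- Let M(n, m) be the space of real n × m matrices and let W ⊆ M(n, m) be the sum of the subspace of matrices with constant rows and the subspace of matrices with constant columns. Let ‖·‖ be any norm on M(n, m) such that for every pair of permutations σ of {1, ..., n} and γ of {1, ..., m}, the map T_{σ,γ} defined by (T_{σ,γ} A)(i, j) = A(σ(i), γ(j)) is an isometry (for example, any l_p norm on the entries). Then the map Q : M(n, m) → W defined by (Q A)(i, j) = (1/m) Σ_{j'=1}^{m} A(i, j') + (1/n) Σ_{i'=1}^{n} A(i', j) − (1/(nm)) Σ_{i'=1}^{n} Σ_{j'=1}^{m} A(i', j') is the unique linear projection of M(n, m) onto W commuting with all the maps T_{σ,γ}, and Q is a minimal projection: ‖Q‖ ≤ ‖P‖ for every linear projection P of M(n, m) onto W, where operator norms are induced by ‖·‖. -/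

import Mathlib

noncomputable section

/-- Matrices with constant rows (all columns equal: entries depend only on the row index). -/
def constRows (n m : ℕ) : Submodule ℝ (Matrix (Fin n) (Fin m) ℝ) where
  carrier := {A | ∀ (i : Fin n) (j j' : Fin m), A i j = A i j'}
  add_mem' := fun hA hB i j j' => by simp [hA i j j', hB i j j']
  zero_mem' := fun i j j' => rfl
  smul_mem' := fun c A hA i j j' => by simp [hA i j j']

/-- Matrices with constant columns (all rows equal: entries depend only on the column index). -/
def constCols (n m : ℕ) : Submodule ℝ (Matrix (Fin n) (Fin m) ℝ) where
  carrier := {A | ∀ (i i' : Fin n) (j : Fin m), A i j = A i' j}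
  add_mem' := fun hA hB i i' j => by simp [hA i i' j, hB i i' j]
  zero_mem' := fun i i' j => rfl
  smul_mem' := fun c A hA i i' j => by simp [hA i i' j]

/-- `W = M(n,1) + M(1,m)`: the sum of the matrices with constant rows and those with
constant columns. -/
def constRowsAddCols (n m : ℕ) : Submodule ℝ (Matrix (Fin n) (Fin m) ℝ) :=
  constRows n m ⊔ constCols n m

/-- The action of a pair of permutations: `(T_{σ,γ} A)(i,j) = A(σ i, γ j)`. -/
def permMat {n m : ℕ} (σ : Equiv.Perm (Fin n)) (γ : Equiv.Perm (Fin m))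
    (A : Matrix (Fin n) (Fin m) ℝ) : Matrix (Fin n) (Fin m) ℝ :=
  Matrix.of fun i j => A (σ i) (γ j)

/-- The operator "norm" of a linear map `T` with respect to a norm-function `N`:
`sup { N (T A) : N A ≤ 1 }`. -/
def opNormOf {M : Type*} [AddCommGroup M] [Module ℝ M] (N : M → ℝ) (T : M →ₗ[ℝ] M) : ℝ :=
  sSup {r : ℝ | ∃ A : M, N A ≤ 1 ∧ r = N (T A)}

theorem exists_bound_of_norm {M : Type*} [AddCommGroup M] [Module ℝ M] [FiniteDimensional ℝ M]
    (N : M → ℝ) (hNzero : ∀ A, N A = 0 ↔ A = 0)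
    (hNsmul : ∀ (c : ℝ) (A), N (c • A) = |c| * N A)
    (hNadd : ∀ A B, N (A + B) ≤ N A + N B) (T : M →ₗ[ℝ] M) :
    ∃ C, 0 ≤ C ∧ ∀ A, N (T A) ≤ C * N A := by
  have hnonneg : ∀ A, 0 ≤ N A := fun A => by
    have h := hNadd A ((-1 : ℝ) • A)
    rw [hNsmul, neg_one_smul, add_neg_cancel, (hNzero 0).2 rfl] at h
    norm_num at h
    linarith
  let : Norm M := ⟨N⟩
  have core : NormedSpace.Core ℝ M :=
    { norm_nonneg := hnonneg
      norm_smul := hNsmul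
      norm_triangle := hNadd
      norm_eq_zero_iff := hNzero }
  let : NormedAddCommGroup M := NormedAddCommGroup.ofCore core
  let : NormedSpace ℝ M := NormedSpace.ofCore core
  exact ⟨‖LinearMap.toContinuousLinearMap T‖, norm_nonneg _,
    (LinearMap.toContinuousLinearMap T).le_opNorm⟩

theorem mem_constRowsAddCols {n m : ℕ} {A : Matrix (Fin n) (Fin m) ℝ} (hn : 0 < n) (hm : 0 < m) :
    A ∈ constRowsAddCols n m ↔
      ∃ (r : Fin n → ℝ) (c : Fin m → ℝ), ∀ i j, A i j = r i + c j := by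
  constructor
  · intro h
    obtain ⟨R, hR, C, hC, rfl⟩ := Submodule.mem_sup.1 h
    exact ⟨fun i => R i ⟨0, hm⟩, fun j => C ⟨0, hn⟩ j, fun i j =>
      congrArg₂ (· + ·) (hR i j _) (hC i _ j)⟩
  · rintro ⟨r, c, h⟩
    exact Submodule.mem_sup.2 ⟨Matrix.of fun i _ => r i, fun _ _ _ => rfl,
      Matrix.of fun _ j => c j, fun _ _ _ => rfl, by ext i j; simp [h]⟩

/-- `permMat σ γ` as a linear map. -/
def permMatLinear {n m : ℕ} (σ : Equiv.Perm (Fin n)) (γ : Equiv.Perm (Fin m)) :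
    Matrix (Fin n) (Fin m) ℝ →ₗ[ℝ] Matrix (Fin n) (Fin m) ℝ where
  toFun := permMat σ γ
  map_add' _ _ := rfl
  map_smul' _ _ := rfl

@[simp]
theorem permMatLinear_apply {n m : ℕ} (σ : Equiv.Perm (Fin n)) (γ : Equiv.Perm (Fin m))
    (A : Matrix (Fin n) (Fin m) ℝ) : permMatLinear σ γ A = permMat σ γ A := rfl

theorem permMat_permMat {n m : ℕ} (σ σ' : Equiv.Perm (Fin n)) (γ γ' : Equiv.Perm (Fin m))
    (A : Matrix (Fin n) (Fin m) ℝ) :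
    permMat σ γ (permMat σ' γ' A) = permMat (σ' * σ) (γ' * γ) A := rfl

theorem permMat_one {n m : ℕ} (A : Matrix (Fin n) (Fin m) ℝ) : permMat 1 1 A = A := rfl

theorem permMat_mem_constRowsAddCols {n m : ℕ} (hn : 0 < n) (hm : 0 < m)
    (σ : Equiv.Perm (Fin n)) (γ : Equiv.Perm (Fin m))
    {A : Matrix (Fin n) (Fin m) ℝ} (hA : A ∈ constRowsAddCols n m) :
    permMat σ γ A ∈ constRowsAddCols n m := by
  obtain ⟨r, c, h⟩ := (mem_constRowsAddCols hn hm).1 hA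
  exact (mem_constRowsAddCols hn hm).2 ⟨r ∘ σ, c ∘ γ, fun i j => h (σ i) (γ j)⟩

theorem sum_permMat_addRight_cols {n m : ℕ} [NeZero m] (A : Matrix (Fin n) (Fin m) ℝ) :
    ∑ k : Fin m, permMat 1 (Equiv.addRight k) A = Matrix.of fun i _ => ∑ j, A i j := by
  ext i j
  rw [Matrix.sum_apply]
  exact Equiv.sum_comp (Equiv.addLeft j) (A i)

theorem sum_permMat_addRight_rows {n m : ℕ} [NeZero n] (A : Matrix (Fin n) (Fin m) ℝ) :
    ∑ k : Fin n, permMat (Equiv.addRight k) 1 A = Matrix.of fun _ j => ∑ i, A i j := by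
  ext i j
  rw [Matrix.sum_apply]
  exact Equiv.sum_comp (Equiv.addLeft i) (fun i => A i j)

theorem rowSum_eq_zero_of_commute {n m : ℕ} [NeZero m]
    {P : Matrix (Fin n) (Fin m) ℝ →ₗ[ℝ] Matrix (Fin n) (Fin m) ℝ}
    (hP : ∀ (σ : Equiv.Perm (Fin n)) (γ : Equiv.Perm (Fin m)) (A),
      P (permMat σ γ A) = permMat σ γ (P A))
    {A : Matrix (Fin n) (Fin m) ℝ} (hA : ∀ i, ∑ j, A i j = 0) (i : Fin n) :
    ∑ j, P A i j = 0 := by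
  have h := congrArg P (sum_permMat_addRight_cols A)
  rw [map_sum] at h
  simp_rw [hP, hA] at h
  rw [sum_permMat_addRight_cols] at h
  exact (congrFun (congrFun h i) 0).trans (congrFun (congrFun (map_zero P) i) 0)

theorem colSum_eq_zero_of_commute {n m : ℕ} [NeZero n]
    {P : Matrix (Fin n) (Fin m) ℝ →ₗ[ℝ] Matrix (Fin n) (Fin m) ℝ}
    (hP : ∀ (σ : Equiv.Perm (Fin n)) (γ : Equiv.Perm (Fin m)) (A),
      P (permMat σ γ A) = permMat σ γ (P A))
    {A : Matrix (Fin n) (Fin m) ℝ} (hA : ∀ j, ∑ i, A i j = 0) (j : Fin m) :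
    ∑ i, P A i j = 0 := by
  have h := congrArg P (sum_permMat_addRight_rows A)
  rw [map_sum] at h
  simp_rw [hP, hA] at h
  rw [sum_permMat_addRight_rows] at h
  exact (congrFun (congrFun h 0) j).trans (congrFun (congrFun (map_zero P) 0) j)

/-- The average of the conjugates of `P` by the maps `permMat σ γ`. -/
def permAverage {n m : ℕ} (P : Matrix (Fin n) (Fin m) ℝ →ₗ[ℝ] Matrix (Fin n) (Fin m) ℝ) :
    Matrix (Fin n) (Fin m) ℝ →ₗ[ℝ] Matrix (Fin n) (Fin m) ℝ :=
  (Fintype.card (Equiv.Perm (Fin n) × Equiv.Perm (Fin m)) : ℝ)⁻¹ •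
    ∑ g : Equiv.Perm (Fin n) × Equiv.Perm (Fin m),
      permMatLinear g.1⁻¹ g.2⁻¹ ∘ₗ P ∘ₗ permMatLinear g.1 g.2

theorem permAverage_apply {n m : ℕ}
    (P : Matrix (Fin n) (Fin m) ℝ →ₗ[ℝ] Matrix (Fin n) (Fin m) ℝ)
    (A : Matrix (Fin n) (Fin m) ℝ) :
    permAverage P A = (Fintype.card (Equiv.Perm (Fin n) × Equiv.Perm (Fin m)) : ℝ)⁻¹ •
      ∑ g : Equiv.Perm (Fin n) × Equiv.Perm (Fin m),
        permMat g.1⁻¹ g.2⁻¹ (P (permMat g.1 g.2 A)) := by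
  simp [permAverage, LinearMap.sum_apply]

theorem permAverage_permMat {n m : ℕ}
    (P : Matrix (Fin n) (Fin m) ℝ →ₗ[ℝ] Matrix (Fin n) (Fin m) ℝ)
    (σ : Equiv.Perm (Fin n)) (γ : Equiv.Perm (Fin m)) (A : Matrix (Fin n) (Fin m) ℝ) :
    permAverage P (permMat σ γ A) = permMat σ γ (permAverage P A) := by
  rw [← permMatLinear_apply σ γ (permAverage P A), permAverage_apply, permAverage_apply,
    map_smul, map_sum]
  congr 1
  refine Fintype.sum_equiv (Equiv.mulLeft (σ, γ)) _ _ fun g => ?_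
  simp [permMat_permMat, mul_assoc]

theorem permAverage_mem_constRowsAddCols {n m : ℕ} (hn : 0 < n) (hm : 0 < m)
    {P : Matrix (Fin n) (Fin m) ℝ →ₗ[ℝ] Matrix (Fin n) (Fin m) ℝ}
    (hP : ∀ A, P A ∈ constRowsAddCols n m) (A : Matrix (Fin n) (Fin m) ℝ) :
    permAverage P A ∈ constRowsAddCols n m := by
  rw [permAverage_apply]
  exact Submodule.smul_mem _ _ (Submodule.sum_mem _ fun _ _ =>
    permMat_mem_constRowsAddCols hn hm _ _ (hP _))

theorem permAverage_eq_self {n m : ℕ} (hn : 0 < n) (hm : 0 < m)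
    {P : Matrix (Fin n) (Fin m) ℝ →ₗ[ℝ] Matrix (Fin n) (Fin m) ℝ}
    (hP : ∀ B ∈ constRowsAddCols n m, P B = B)
    {B : Matrix (Fin n) (Fin m) ℝ} (hB : B ∈ constRowsAddCols n m) :
    permAverage P B = B := by
  have h : ∀ g : Equiv.Perm (Fin n) × Equiv.Perm (Fin m),
      permMat g.1⁻¹ g.2⁻¹ (P (permMat g.1 g.2 B)) = B := fun g => by
    rw [hP _ (permMat_mem_constRowsAddCols hn hm _ _ hB), permMat_permMat, mul_inv_cancel,
      mul_inv_cancel, permMat_one]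
  rw [permAverage_apply, Finset.sum_congr rfl fun g _ => h g, Finset.sum_const, Finset.card_univ,
    ← Nat.cast_smul_eq_nsmul ℝ, smul_smul,
    inv_mul_cancel₀ (Nat.cast_ne_zero.2 Fintype.card_ne_zero), one_smul]

theorem opNormOf_permAverage_le {n m : ℕ}
    (N : Matrix (Fin n) (Fin m) ℝ → ℝ)
    (hNzero : ∀ A, N A = 0 ↔ A = 0)
    (hNsmul : ∀ (c : ℝ) (A), N (c • A) = |c| * N A)
    (hNadd : ∀ A B, N (A + B) ≤ N A + N B)
    (hNiso : ∀ (σ : Equiv.Perm (Fin n)) (γ : Equiv.Perm (Fin m)) (A), N (permMat σ γ A) = N A)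
    (P : Matrix (Fin n) (Fin m) ℝ →ₗ[ℝ] Matrix (Fin n) (Fin m) ℝ) :
    opNormOf N (permAverage P) ≤ opNormOf N P := by
  obtain ⟨C, hC, hbound⟩ := exists_bound_of_norm N hNzero hNsmul hNadd P
  have hbdd : BddAbove {r : ℝ | ∃ A, N A ≤ 1 ∧ r = N (P A)} := by
    refine ⟨C, ?_⟩
    rintro _ ⟨A, hA, rfl⟩
    exact (hbound A).trans (mul_le_of_le_one_right hC hA)
  refine csSup_le ⟨_, 0, by rw [(hNzero 0).2 rfl]; exact zero_le_one, rfl⟩ ?_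
  rintro _ ⟨A, hA, rfl⟩
  have hcard : (0 : ℝ) < Fintype.card (Equiv.Perm (Fin n) × Equiv.Perm (Fin m)) :=
    Nat.cast_pos.2 Fintype.card_pos
  rw [permAverage_apply, hNsmul, abs_of_pos (inv_pos.2 hcard), inv_mul_le_iff₀ hcard]
  refine (Finset.le_sum_of_subadditive N ((hNzero 0).2 rfl).le hNadd _ _).trans ?_
  refine (Finset.sum_le_card_nsmul _ _ (opNormOf N P) fun g _ => ?_).trans_eq ?_
  · rw [hNiso]
    exact le_csSup hbdd ⟨_, by rwa [hNiso], rfl⟩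
  · rw [nsmul_eq_mul, Finset.card_univ]

/-- Let `W ⊆ M(n,m)` be the sum of the matrices with constant rows and those with constant
columns, and let `N` be any norm on `M(n,m)` for which every map `(T_{σ,γ}A)(i,j) = A(σ i, γ j)`
is an isometry. Then the map
`(Q A)(i,j) = (1/m) ∑_{j'} A(i,j') + (1/n) ∑_{i'} A(i',j) − (1/(nm)) ∑_{i',j'} A(i',j')`
is the unique linear projection of `M(n,m)` onto `W` commuting with all the `T_{σ,γ}`, and `Q`
is a minimal projection with respect to the operator norm induced by `N`. -/
theorem matrix_unique_commuting_projection_minimal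
    (n m : ℕ) (hn : 0 < n) (hm : 0 < m)
    (N : Matrix (Fin n) (Fin m) ℝ → ℝ)
    (hNzero : ∀ A, N A = 0 ↔ A = 0)
    (hNsmul : ∀ (c : ℝ) (A), N (c • A) = |c| * N A)
    (hNadd : ∀ A B, N (A + B) ≤ N A + N B)
    (hNiso : ∀ (σ : Equiv.Perm (Fin n)) (γ : Equiv.Perm (Fin m)) (A), N (permMat σ γ A) = N A)
    (Q : Matrix (Fin n) (Fin m) ℝ →ₗ[ℝ] Matrix (Fin n) (Fin m) ℝ)
    (hQ : ∀ (A : Matrix (Fin n) (Fin m) ℝ) (i : Fin n) (j : Fin m),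
      Q A i j = (1 / (m : ℝ)) * ∑ j' : Fin m, A i j' + (1 / (n : ℝ)) * ∑ i' : Fin n, A i' j -
        (1 / ((n : ℝ) * (m : ℝ))) * ∑ i' : Fin n, ∑ j' : Fin m, A i' j') :
    -- `Q` is a projection onto `W` commuting with all the maps `T_{σ,γ}`,
    (∀ A, Q A ∈ constRowsAddCols n m) ∧
    (∀ B ∈ constRowsAddCols n m, Q B = B) ∧
    (∀ (σ : Equiv.Perm (Fin n)) (γ : Equiv.Perm (Fin m)) (A),
      Q (permMat σ γ A) = permMat σ γ (Q A)) ∧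
    -- it is the unique such projection,
    (∀ P : Matrix (Fin n) (Fin m) ℝ →ₗ[ℝ] Matrix (Fin n) (Fin m) ℝ,
      (∀ A, P A ∈ constRowsAddCols n m) → (∀ B ∈ constRowsAddCols n m, P B = B) →
      (∀ (σ : Equiv.Perm (Fin n)) (γ : Equiv.Perm (Fin m)) (A),
        P (permMat σ γ A) = permMat σ γ (P A)) → P = Q) ∧
    -- and `Q` is minimal among all projections of `M(n,m)` onto `W`:
    (∀ P : Matrix (Fin n) (Fin m) ℝ →ₗ[ℝ] Matrix (Fin n) (Fin m) ℝ,
      (∀ A, P A ∈ constRowsAddCols n m) → (∀ B ∈ constRowsAddCols n m, P B = B) →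
      opNormOf N Q ≤ opNormOf N P) := by
  have : NeZero n := ⟨hn.ne'⟩
  have : NeZero m := ⟨hm.ne'⟩
  have hn0 : (n : ℝ) ≠ 0 := Nat.cast_ne_zero.2 hn.ne'
  have hm0 : (m : ℝ) ≠ 0 := Nat.cast_ne_zero.2 hm.ne'
  have hQmem : ∀ A, Q A ∈ constRowsAddCols n m := fun A =>
    (mem_constRowsAddCols hn hm).2
      ⟨fun i => (1 / (m : ℝ)) * ∑ j', A i j',
        fun j => (1 / (n : ℝ)) * ∑ i', A i' j -
          (1 / ((n : ℝ) * (m : ℝ))) * ∑ i', ∑ j', A i' j',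
        fun i j => by rw [hQ]; ring⟩
  have hQself : ∀ B ∈ constRowsAddCols n m, Q B = B := fun B hB => by
    obtain ⟨r, c, h⟩ := (mem_constRowsAddCols hn hm).1 hB
    ext i j
    rw [hQ]
    simp only [h, Finset.sum_add_distrib, Finset.sum_const, Finset.card_univ, Fintype.card_fin,
      nsmul_eq_mul, ← Finset.mul_sum]
    field_simp
    ring
  have hQcomm : ∀ (σ : Equiv.Perm (Fin n)) (γ : Equiv.Perm (Fin m)) (A),
      Q (permMat σ γ A) = permMat σ γ (Q A) := fun σ γ A => by
    ext i j
    have hrow : ∀ i, ∑ j', A i (γ j') = ∑ j', A i j' := fun i => Equiv.sum_comp γ (A i)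
    have hcol : ∀ f : Fin n → ℝ, ∑ i', f (σ i') = ∑ i', f i' := Equiv.sum_comp σ
    simp only [permMat, Matrix.of_apply, hQ, hrow]
    rw [hcol fun i => A i (γ j), hcol fun i => ∑ j', A i j']
  have hQrow : ∀ A i, ∑ j, (A - Q A) i j = 0 := fun A i => by
    simp only [Matrix.sub_apply, hQ, Finset.sum_sub_distrib, Finset.sum_add_distrib,
      Finset.sum_const, Finset.card_univ, Fintype.card_fin, nsmul_eq_mul, ← Finset.mul_sum]
    rw [Finset.sum_comm (f := fun j i' => A i' j)]
    field_simp
    ring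
  have hQcol : ∀ A j, ∑ i, (A - Q A) i j = 0 := fun A j => by
    simp only [Matrix.sub_apply, hQ, Finset.sum_sub_distrib, Finset.sum_add_distrib,
      Finset.sum_const, Finset.card_univ, Fintype.card_fin, nsmul_eq_mul, ← Finset.mul_sum]
    field_simp
    ring
  have hunique : ∀ P : Matrix (Fin n) (Fin m) ℝ →ₗ[ℝ] Matrix (Fin n) (Fin m) ℝ,
      (∀ A, P A ∈ constRowsAddCols n m) → (∀ B ∈ constRowsAddCols n m, P B = B) →
      (∀ (σ : Equiv.Perm (Fin n)) (γ : Equiv.Perm (Fin m)) (A),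
        P (permMat σ γ A) = permMat σ γ (P A)) → P = Q := fun P hPmem hPself hPcomm => by
    refine LinearMap.ext fun A => ?_
    have hzero : P (A - Q A) = 0 := by
      rw [← hQself _ (hPmem _)]
      ext i j
      rw [hQ]
      simp only [rowSum_eq_zero_of_commute hPcomm (hQrow A),
        colSum_eq_zero_of_commute hPcomm (hQcol A)]
      simp
    rwa [map_sub, hPself _ (hQmem A), sub_eq_zero] at hzero
  refine ⟨hQmem, hQself, hQcomm, hunique, fun P hPmem hPself => ?_⟩
  rw [← hunique (permAverage P) (permAverage_mem_constRowsAddCols hn hm hPmem)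
    (fun B hB => permAverage_eq_self hn hm hPself hB) (permAverage_permMat P)]
  exact opNormOf_permAverage_le N hNzero hNsmul hNadd hNiso P
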